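/- Fix parameters δ ∈ (0, π/4], α, β, γ ∈ (0, π/2], φ ∈ [0, 2π), set φ_A = cos α·|0⟩ + sin α·|1⟩, φ_B = cos β·|0⟩ + sin β·|1⟩, φ_C = cos γ·|0⟩ + sin γ·|1⟩, t = 2·cos δ·sin δ·cos α·cos β·cos γ·cos φ, K = 1/(1+t), and let Ψ = √K·(cos δ·|000⟩ + sin δ·e^{iφ}·φ_A⊗φ_B⊗φ_C). Then for every complete product family {O_i}_{i∈F} on ℂ²⊗ℂ²⊗ℂ², letting S = {i ∈ F : O_i|GHZ⟩ is a complex scalar multiple of Ψ}, one has ∑_{i∈S} ‖O_i|GHZ⟩‖² ≤ (1+t)/(1−t). (This bounds the probability of converting |GHZ⟩ into the GHZ-class state Ψ by stochastic LOCC.) -/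

import Mathlib

noncomputable section

open Classical Matrix

/-- Tensor product of three vectors of `ℂ²`, realized inside
`EuclideanSpace ℂ (Fin 2 × Fin 2 × Fin 2)` (the three-qubit Hilbert space). -/
def tp3 (a b c : EuclideanSpace ℂ (Fin 2)) : EuclideanSpace ℂ (Fin 2 × Fin 2 × Fin 2) :=
  (WithLp.equiv 2 _).symm fun p => a p.1 * b p.2.1 * c p.2.2

/-- The product operator `A ⊗ B ⊗ C` on the three-qubit Hilbert space, as a matrix. -/
def kron3 (A B C : Matrix (Fin 2) (Fin 2) ℂ) :
    Matrix (Fin 2 × Fin 2 × Fin 2) (Fin 2 × Fin 2 × Fin 2) ℂ :=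
  fun p q => A p.1 q.1 * B p.2.1 q.2.1 * C p.2.2 q.2.2

/-- The computational basis vector `|i⟩` of `ℂ²`. -/
def ket (i : Fin 2) : EuclideanSpace ℂ (Fin 2) := EuclideanSpace.single i 1

/-- The GHZ state `(|000⟩ + |111⟩)/√2`. -/
def GHZ : EuclideanSpace ℂ (Fin 2 × Fin 2 × Fin 2) :=
  (Real.sqrt 2 : ℂ)⁻¹ • (tp3 (ket 0) (ket 0) (ket 0) + tp3 (ket 1) (ket 1) (ket 1))

/-- Scalar core of the uniqueness of the GHZ decomposition, in coordinates where the target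
tensor is diagonal: the two product terms are diagonal as well, up to exchange. -/
theorem diagonal_tensor_unique {a b c a' b' c' : Fin 2 → ℂ} {x y : ℂ} (hx : x ≠ 0) (hy : y ≠ 0)
    (h000 : a 0 * b 0 * c 0 + a' 0 * b' 0 * c' 0 = x)
    (h111 : a 1 * b 1 * c 1 + a' 1 * b' 1 * c' 1 = y)
    (h001 : a 0 * b 0 * c 1 + a' 0 * b' 0 * c' 1 = 0)
    (h010 : a 0 * b 1 * c 0 + a' 0 * b' 1 * c' 0 = 0)
    (h100 : a 1 * b 0 * c 0 + a' 1 * b' 0 * c' 0 = 0)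
    (h011 : a 0 * b 1 * c 1 + a' 0 * b' 1 * c' 1 = 0)
    (h101 : a 1 * b 0 * c 1 + a' 1 * b' 0 * c' 1 = 0)
    (h110 : a 1 * b 1 * c 0 + a' 1 * b' 1 * c' 0 = 0) :
    (a 1 = 0 ∧ b 1 = 0 ∧ c 1 = 0 ∧ a' 0 = 0 ∧ b' 0 = 0 ∧ c' 0 = 0) ∨
    (a' 1 = 0 ∧ b' 1 = 0 ∧ c' 1 = 0 ∧ a 0 = 0 ∧ b 0 = 0 ∧ c 0 = 0) := by
  have hxy := mul_ne_zero hx hy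
  have split (p q r s D : ℂ) (hD : (p * s + q * r) * D ≠ 0)
      (h₀ : p * r * D = 0) (h₁ : q * s * D = 0) : (q = 0 ∧ r = 0) ∨ (p = 0 ∧ s = 0) := by
    obtain ⟨h, hD⟩ := mul_ne_zero_iff.mp hD
    simp only [mul_eq_zero, hD, or_false] at h₀ h₁
    rcases h₀ with rfl | rfl <;> rcases h₁ with rfl | rfl <;> simp_all
  have hc := split (c 0) (c 1) (c' 0) (c' 1)
    ((a 0 * a' 1 - a 1 * a' 0) * (b 0 * b' 1 - b 1 * b' 0))
    (by convert hxy using 1; grind) (by grind) (by grind)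
  have hb := split (b 0) (b 1) (b' 0) (b' 1)
    ((a 0 * a' 1 - a 1 * a' 0) * (c 0 * c' 1 - c 1 * c' 0))
    (by convert hxy using 1; grind) (by grind) (by grind)
  have ha := split (a 0) (a 1) (a' 0) (a' 1)
    ((b 0 * b' 1 - b 1 * b' 0) * (c 0 * c' 1 - c 1 * c' 0))
    (by convert hxy using 1; grind) (by grind) (by grind)
  rcases ha with ⟨ha, ha'⟩ | ⟨ha, ha'⟩ <;> rcases hb with ⟨hb, hb'⟩ | ⟨hb, hb'⟩ <;>
    rcases hc with ⟨hc, hc'⟩ | ⟨hc, hc'⟩ <;> simp_all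

@[simp]
theorem tp3_apply (a b c : EuclideanSpace ℂ (Fin 2)) (p : Fin 2 × Fin 2 × Fin 2) :
    tp3 a b c p = a p.1 * b p.2.1 * c p.2.2 := rfl

/-- If a sum of two product vectors equals `x |000⟩ + y u ⊗ v ⊗ w` with `u, v, w` not
proportional to `|0⟩`, then the terms agree up to exchange, hence so do the differences up to
sign. -/
theorem tp3_sub_eq_or_eq_neg {a b c a' b' c' u v w : EuclideanSpace ℂ (Fin 2)} {x y : ℂ}
    (hx : x ≠ 0) (hy : y ≠ 0) (hu : u 1 ≠ 0) (hv : v 1 ≠ 0) (hw : w 1 ≠ 0)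
    (h : tp3 a b c + tp3 a' b' c' = x • tp3 (ket 0) (ket 0) (ket 0) + y • tp3 u v w) :
    tp3 a b c - tp3 a' b' c' = x • tp3 (ket 0) (ket 0) (ket 0) - y • tp3 u v w ∨
    tp3 a b c - tp3 a' b' c' = -(x • tp3 (ket 0) (ket 0) (ket 0) - y • tp3 u v w) := by
  suffices H : tp3 a b c = x • tp3 (ket 0) (ket 0) (ket 0) ∨
      tp3 a' b' c' = x • tp3 (ket 0) (ket 0) (ket 0) by
    rcases H with H | H
    · left
      rw [H] at h ⊢
      rw [add_left_cancel h]
    · right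
      rw [H, add_comm] at h
      rw [H, add_left_cancel h, neg_sub]
  have key (i j k : Fin 2) := congrArg (fun z => z (i, j, k)) h
  simp only [PiLp.add_apply, PiLp.smul_apply, tp3_apply, smul_eq_mul, ket,
    PiLp.single_apply] at key
  have h000 := key 0 0 0
  have h001 := key 0 0 1
  have h010 := key 0 1 0
  have h011 := key 0 1 1
  have h100 := key 1 0 0
  have h101 := key 1 0 1
  have h110 := key 1 1 0
  have h111 := key 1 1 1
  clear key
  norm_num at h000 h001 h010 h011 h100 h101 h110 h111
  have huvw := mul_ne_zero (mul_ne_zero hu hv) hw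
  have h₀ : (a 0 * u 1 - a 1 * u 0) * (b 0 * v 1 - b 1 * v 0) * (c 0 * w 1 - c 1 * w 0) +
      (a' 0 * u 1 - a' 1 * u 0) * (b' 0 * v 1 - b' 1 * v 0) * (c' 0 * w 1 - c' 1 * w 0) =
      x * (u 1 * v 1 * w 1) := by
    linear_combination u 1 * v 1 * w 1 * h000 - u 1 * v 1 * w 0 * h001 - u 1 * v 0 * w 1 * h010 +
      u 1 * v 0 * w 0 * h011 - u 0 * v 1 * w 1 * h100 + u 0 * v 1 * w 0 * h101 +
      u 0 * v 0 * w 1 * h110 - u 0 * v 0 * w 0 * h111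
  rcases diagonal_tensor_unique
      (a := ![a 0 * u 1 - a 1 * u 0, a 1]) (a' := ![a' 0 * u 1 - a' 1 * u 0, a' 1])
      (b := ![b 0 * v 1 - b 1 * v 0, b 1]) (b' := ![b' 0 * v 1 - b' 1 * v 0, b' 1])
      (c := ![c 0 * w 1 - c 1 * w 0, c 1]) (c' := ![c' 0 * w 1 - c' 1 * w 0, c' 1])
      (mul_ne_zero hx huvw) (mul_ne_zero hy huvw) h₀ h111
      (by
        simp only [Matrix.cons_val]
        linear_combination u 1 * v 1 * h001 - u 1 * v 0 * h011 - u 0 * v 1 * h101 +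
          u 0 * v 0 * h111)
      (by
        simp only [Matrix.cons_val]
        linear_combination u 1 * w 1 * h010 - u 1 * w 0 * h011 - u 0 * w 1 * h110 +
          u 0 * w 0 * h111)
      (by
        simp only [Matrix.cons_val]
        linear_combination v 1 * w 1 * h100 - v 1 * w 0 * h101 - v 0 * w 1 * h110 +
          v 0 * w 0 * h111)
      (by simp only [Matrix.cons_val]; linear_combination u 1 * h011 - u 0 * h111)
      (by simp only [Matrix.cons_val]; linear_combination v 1 * h101 - v 0 * h111)
      (by simp only [Matrix.cons_val]; linear_combination w 1 * h110 - w 0 * h111) with H | H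
  · left
    simp only [Matrix.cons_val] at H
    obtain ⟨h1, h2, h3, h4, h5, h6⟩ := H
    rw [h1, h2, h3, h4] at h₀
    have e : a 0 * b 0 * c 0 = x := mul_right_cancel₀ huvw (by linear_combination h₀)
    ext ⟨i, j, k⟩
    fin_cases i <;> fin_cases j <;> fin_cases k <;> simp [ket, h1, h2, h3, e]
  · right
    simp only [Matrix.cons_val] at H
    obtain ⟨h1, h2, h3, h4, h5, h6⟩ := H
    rw [h1, h2, h3, h4] at h₀
    have e : a' 0 * b' 0 * c' 0 = x := mul_right_cancel₀ huvw (by linear_combination h₀)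
    ext ⟨i, j, k⟩
    fin_cases i <;> fin_cases j <;> fin_cases k <;> simp [ket, h1, h2, h3, e]

theorem toEuclideanLin_kron3_tp3 (A B C : Matrix (Fin 2) (Fin 2) ℂ)
    (a b c : EuclideanSpace ℂ (Fin 2)) :
    Matrix.toEuclideanLin (kron3 A B C) (tp3 a b c) =
      tp3 (Matrix.toEuclideanLin A a) (Matrix.toEuclideanLin B b)
        (Matrix.toEuclideanLin C c) := by
  ext p
  simp only [tp3_apply, Matrix.toLpLin_apply, Matrix.mulVec, dotProduct, kron3,
    Fintype.sum_prod_type, Fin.sum_univ_two]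
  ring

theorem inner_tp3 (a b c a' b' c' : EuclideanSpace ℂ (Fin 2)) :
    inner ℂ (tp3 a b c) (tp3 a' b' c') = inner ℂ a a' * inner ℂ b b' * inner ℂ c c' := by
  simp [PiLp.inner_apply, Fintype.sum_prod_type]
  ring

/-- A complete family of operators preserves the total squared norm. -/
theorem sum_norm_sq_toEuclideanLin {ι m : Type*} [Fintype ι] [Fintype m] [DecidableEq m]
    (O : ι → Matrix m m ℂ) (hO : ∑ i, (O i)ᴴ * O i = 1) (v : EuclideanSpace ℂ m) :
    ∑ i, ‖Matrix.toEuclideanLin (O i) v‖ ^ 2 = ‖v‖ ^ 2 := by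
  have h (i : ι) : ((‖Matrix.toEuclideanLin (O i) v‖ ^ 2 : ℝ) : ℂ) =
      inner ℂ v (Matrix.toEuclideanLin ((O i)ᴴ * O i) v) := by
    rw [Matrix.toLpLin_mul_same, LinearMap.comp_apply, Matrix.toEuclideanLin_conjTranspose_eq_adjoint,
      LinearMap.adjoint_inner_right, inner_self_eq_norm_sq_to_K]
    simp
  apply Complex.ofReal_injective
  rw [Complex.ofReal_sum]
  simp_rw [h]
  rw [← inner_sum, ← LinearMap.sum_apply, ← map_sum, hO, Matrix.toLpLin_one, LinearMap.id_apply,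
    inner_self_eq_norm_sq_to_K]
  simp

theorem inner_qubit (θ η : ℝ) :
    inner ℂ ((Real.cos θ : ℂ) • ket 0 + (Real.sin θ : ℂ) • ket 1)
      ((Real.cos η : ℂ) • ket 0 + (Real.sin η : ℂ) • ket 1) = (Real.cos (θ - η) : ℂ) := by
  rw [Real.cos_sub]
  simp [PiLp.inner_apply, ket, ← Complex.cos_conj, ← Complex.sin_conj]
  ring

/-- Squared norm of a combination of unit vectors with prescribed overlap. -/
theorem norm_sq_superposition {E : Type*} [NormedAddCommGroup E] [InnerProductSpace ℂ E]
    {e f : E} {δ φ r : ℝ} (he : inner ℂ e e = (1 : ℂ)) (hf : inner ℂ f f = (1 : ℂ))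
    (hr : inner ℂ e f = (r : ℂ)) :
    ‖(Real.cos δ : ℂ) • e + ((Real.sin δ : ℂ) * Complex.exp (φ * Complex.I)) • f‖ ^ 2 =
        1 + 2 * Real.cos δ * Real.sin δ * r * Real.cos φ ∧
      ‖(Real.cos δ : ℂ) • e - ((Real.sin δ : ℂ) * Complex.exp (φ * Complex.I)) • f‖ ^ 2 =
        1 - 2 * Real.cos δ * Real.sin δ * r * Real.cos φ := by
  have hne : ‖e‖ = 1 := by
    have : ‖e‖ ^ 2 = 1 := by rw [← inner_self_eq_norm_sq (𝕜 := ℂ), he, RCLike.one_re]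
    nlinarith [norm_nonneg e]
  have hnf : ‖f‖ = 1 := by
    have : ‖f‖ ^ 2 = 1 := by rw [← inner_self_eq_norm_sq (𝕜 := ℂ), hf, RCLike.one_re]
    nlinarith [norm_nonneg f]
  have hi : RCLike.re (inner ℂ ((Real.cos δ : ℂ) • e)
      (((Real.sin δ : ℂ) * Complex.exp (φ * Complex.I)) • f)) =
      Real.cos δ * Real.sin δ * r * Real.cos φ := by
    rw [inner_smul_left, inner_smul_right, hr, Complex.conj_ofReal, Complex.exp_mul_I,
      ← Complex.ofReal_cos, ← Complex.ofReal_sin]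
    simp [-Complex.ofReal_cos, -Complex.ofReal_sin]
    ring
  have h1 : ‖(Real.cos δ : ℂ) • e‖ ^ 2 = Real.cos δ ^ 2 := by
    rw [norm_smul, hne, Complex.norm_real, mul_one, Real.norm_eq_abs, sq_abs]
  have h2 : ‖((Real.sin δ : ℂ) * Complex.exp (φ * Complex.I)) • f‖ ^ 2 = Real.sin δ ^ 2 := by
    rw [norm_smul, hnf, norm_mul, Complex.norm_real, Complex.norm_exp_ofReal_mul_I, mul_one,
      mul_one, Real.norm_eq_abs, sq_abs]
  rw [norm_add_sq (𝕜 := ℂ), norm_sub_sq (𝕜 := ℂ), hi, h1, h2]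
  constructor <;> linarith [Real.sin_sq_add_cos_sq δ]

/-- **Theorem 1 (upper bound for the conversion `|GHZ⟩ → Ψ`).**
For the GHZ-class state
`Ψ = √K (cos δ |000⟩ + sin δ e^{iφ} φ_A ⊗ φ_B ⊗ φ_C)` with
`t = 2 cos δ sin δ cos α cos β cos γ cos φ` and `K = 1/(1+t)`, every complete product
family (stochastic LOCC protocol) has total success probability
`∑_{i ∈ S} ‖Oᵢ|GHZ⟩‖²` at most `(1+t)/(1−t)`, where `S` is the set of branches whose
output is proportional to `Ψ`. -/
theorem ghz_to_ghz_class_upper_bound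
    (δ α β γ φ : ℝ)
    (hδ : δ ∈ Set.Ioc 0 (Real.pi / 4))
    (hα : α ∈ Set.Ioc 0 (Real.pi / 2)) (hβ : β ∈ Set.Ioc 0 (Real.pi / 2))
    (hγ : γ ∈ Set.Ioc 0 (Real.pi / 2)) (hφ : φ ∈ Set.Ico 0 (2 * Real.pi))
    (φA φB φC : EuclideanSpace ℂ (Fin 2))
    (hφA : φA = (Real.cos α : ℂ) • ket 0 + (Real.sin α : ℂ) • ket 1)
    (hφB : φB = (Real.cos β : ℂ) • ket 0 + (Real.sin β : ℂ) • ket 1)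
    (hφC : φC = (Real.cos γ : ℂ) • ket 0 + (Real.sin γ : ℂ) • ket 1)
    (t : ℝ)
    (ht : t = 2 * Real.cos δ * Real.sin δ * Real.cos α * Real.cos β * Real.cos γ * Real.cos φ)
    (Ψ : EuclideanSpace ℂ (Fin 2 × Fin 2 × Fin 2))
    (hΨ : Ψ = (Real.sqrt (1 / (1 + t)) : ℂ) •
        ((Real.cos δ : ℂ) • tp3 (ket 0) (ket 0) (ket 0)
          + ((Real.sin δ : ℂ) * Complex.exp (φ * Complex.I)) • tp3 φA φB φC))
    {n : ℕ} (A B C : Fin n → Matrix (Fin 2) (Fin 2) ℂ)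
    (hcomplete : ∑ i, (kron3 (A i) (B i) (C i))ᴴ * kron3 (A i) (B i) (C i) = 1) :
    ∑ i ∈ Finset.univ.filter (fun i =>
        ∃ c : ℂ, Matrix.toEuclideanLin (kron3 (A i) (B i) (C i)) GHZ = c • Ψ),
      ‖Matrix.toEuclideanLin (kron3 (A i) (B i) (C i)) GHZ‖ ^ 2
      ≤ (1 + t) / (1 - t) := by
  have hsα : 0 < Real.sin α := Real.sin_pos_of_pos_of_lt_pi hα.1 (by linarith [hα.2, Real.pi_pos])
  have hsβ : 0 < Real.sin β := Real.sin_pos_of_pos_of_lt_pi hβ.1 (by linarith [hβ.2, Real.pi_pos])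
  have hsγ : 0 < Real.sin γ := Real.sin_pos_of_pos_of_lt_pi hγ.1 (by linarith [hγ.2, Real.pi_pos])
  have hsδ : 0 < Real.sin δ := Real.sin_pos_of_pos_of_lt_pi hδ.1 (by linarith [hδ.2, Real.pi_pos])
  have hcδ : 0 < Real.cos δ :=
    Real.cos_pos_of_mem_Ioo ⟨by linarith [hδ.1, Real.pi_pos], by linarith [hδ.2, Real.pi_pos]⟩
  have hket (η : ℝ) : inner ℂ (ket 0) ((Real.cos η : ℂ) • ket 0 + (Real.sin η : ℂ) • ket 1) =
      (Real.cos η : ℂ) := by simpa using inner_qubit 0 η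
  have htabs : |t| < 1 := by
    have h1 : |2 * Real.cos δ * Real.sin δ| ≤ 1 := by
      rw [mul_right_comm, ← Real.sin_two_mul]
      exact Real.abs_sin_le_one _
    have h2 : |Real.cos α| < 1 := by
      rw [← sq_lt_one_iff_abs_lt_one]
      nlinarith [Real.sin_sq_add_cos_sq α]
    have h3 : |Real.cos β * Real.cos γ * Real.cos φ| ≤ 1 := by
      rw [abs_mul, abs_mul]
      exact mul_le_one₀ (mul_le_one₀ (Real.abs_cos_le_one _) (abs_nonneg _)
        (Real.abs_cos_le_one _)) (abs_nonneg _) (Real.abs_cos_le_one _)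
    have h4 : t = (2 * Real.cos δ * Real.sin δ) * (Real.cos β * Real.cos γ * Real.cos φ) *
        Real.cos α := by rw [ht]; ring
    rw [h4, abs_mul, abs_mul]
    exact mul_lt_one_of_nonneg_of_lt_one_right (mul_le_one₀ h1 (abs_nonneg _) h3)
      (abs_nonneg _) h2
  obtain ⟨ht₀, ht₁⟩ := abs_lt.mp htabs
  have h1t : 0 < 1 + t := by linarith
  set e := tp3 (ket 0) (ket 0) (ket 0) with he
  set f := tp3 φA φB φC with hf
  have hee : inner ℂ e e = (1 : ℂ) := by
    rw [he, inner_tp3]; simp [ket]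
  have hff : inner ℂ f f = (1 : ℂ) := by
    rw [hf, inner_tp3, hφA, hφB, hφC, inner_qubit, inner_qubit, inner_qubit]; simp
  have hef : inner ℂ e f = ((Real.cos α * Real.cos β * Real.cos γ : ℝ) : ℂ) := by
    rw [he, hf, inner_tp3, hφA, hφB, hφC, hket, hket, hket, Complex.ofReal_mul, Complex.ofReal_mul]
  obtain ⟨hplus, hminus⟩ := norm_sq_superposition (δ := δ) (φ := φ) hee hff hef
  have ht' : 2 * Real.cos δ * Real.sin δ * (Real.cos α * Real.cos β * Real.cos γ) *
      Real.cos φ = t := by rw [ht]; ring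
  rw [ht'] at hplus hminus
  set g := tp3 (ket 1) (ket 1) (ket 1) with hg
  have hgg : inner ℂ g g = (1 : ℂ) := by
    rw [hg, inner_tp3]; simp [ket]
  have heg : inner ℂ e g = (0 : ℂ) := by
    rw [he, hg, inner_tp3]; simp [ket, PiLp.inner_apply]
  set M : EuclideanSpace ℂ (Fin 2 × Fin 2 × Fin 2) := (Real.sqrt 2 : ℂ)⁻¹ • (e - g) with hM
  have hMnorm : ‖M‖ ^ 2 = 1 := by
    have h1 : ‖e‖ ^ 2 = 1 := by rw [← inner_self_eq_norm_sq (𝕜 := ℂ), hee, RCLike.one_re]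
    have h2 : ‖g‖ ^ 2 = 1 := by rw [← inner_self_eq_norm_sq (𝕜 := ℂ), hgg, RCLike.one_re]
    rw [hM, norm_smul, mul_pow, norm_sub_sq (𝕜 := ℂ), heg, h1, h2]
    norm_num
  have hbranch (i : Fin n) (hi : ∃ c : ℂ,
      Matrix.toEuclideanLin (kron3 (A i) (B i) (C i)) GHZ = c • Ψ) :
      ‖Matrix.toEuclideanLin (kron3 (A i) (B i) (C i)) GHZ‖ ^ 2 * (1 - t) ≤
        ‖Matrix.toEuclideanLin (kron3 (A i) (B i) (C i)) M‖ ^ 2 * (1 + t) := by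
    obtain ⟨c, hc⟩ := hi
    rcases eq_or_ne c 0 with rfl | hc0
    · rw [hc]
      simp only [zero_smul, norm_zero]
      have := mul_nonneg (sq_nonneg ‖Matrix.toEuclideanLin (kron3 (A i) (B i) (C i)) M‖) h1t.le
      simpa using this
    have hs2 : (Real.sqrt 2 : ℂ) ≠ 0 := by simp
    have hK : (Real.sqrt (1 / (1 + t)) : ℂ) ≠ 0 :=
      Complex.ofReal_ne_zero.mpr (Real.sqrt_ne_zero'.mpr (by positivity))
    set k : ℂ := (Real.sqrt 2 : ℂ) * c * (Real.sqrt (1 / (1 + t)) : ℂ) with hk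
    have hk0 : k ≠ 0 := mul_ne_zero (mul_ne_zero hs2 hc0) hK
    set P := Matrix.toEuclideanLin (kron3 (A i) (B i) (C i)) with hP
    have hsum : P e + P g =
        k • ((Real.cos δ : ℂ) • e + ((Real.sin δ : ℂ) * Complex.exp (φ * Complex.I)) • f) := by
      have h' : P e + P g = (Real.sqrt 2 : ℂ) • P GHZ := by
        rw [GHZ, map_smul, smul_smul, mul_inv_cancel₀ hs2, one_smul, map_add]
      rw [h', hc, hΨ, smul_smul, smul_smul]
    have hdiff : ‖P e - P g‖ =
        ‖k • ((Real.cos δ : ℂ) • e - ((Real.sin δ : ℂ) * Complex.exp (φ * Complex.I)) • f)‖ := by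
      have h' := hsum
      rw [smul_add, smul_smul, smul_smul, he, hg, hP, toEuclideanLin_kron3_tp3,
        toEuclideanLin_kron3_tp3] at h'
      rw [smul_sub, smul_smul, smul_smul, he, hg, hP, toEuclideanLin_kron3_tp3,
        toEuclideanLin_kron3_tp3]
      rcases tp3_sub_eq_or_eq_neg
        (mul_ne_zero hk0 (Complex.ofReal_ne_zero.mpr hcδ.ne'))
        (mul_ne_zero hk0 (mul_ne_zero (Complex.ofReal_ne_zero.mpr hsδ.ne')
          (Complex.exp_ne_zero _)))
        (by rw [hφA]; simpa [ket, -Complex.ofReal_sin] using hsα.ne')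
        (by rw [hφB]; simpa [ket, -Complex.ofReal_sin] using hsβ.ne')
        (by rw [hφC]; simpa [ket, -Complex.ofReal_sin] using hsγ.ne') h' with H | H
      · rw [H]
      · rw [H, norm_neg]
    have e1 : ‖P GHZ‖ ^ 2 = ‖(Real.sqrt 2 : ℂ)⁻¹‖ ^ 2 * (‖k‖ ^ 2 * (1 + t)) := by
      rw [GHZ, map_smul, map_add, hsum, norm_smul, norm_smul, mul_pow, mul_pow, hplus]
    have e2 : ‖P M‖ ^ 2 = ‖(Real.sqrt 2 : ℂ)⁻¹‖ ^ 2 * (‖k‖ ^ 2 * (1 - t)) := by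
      rw [hM, map_smul, map_sub, norm_smul, hdiff, norm_smul, mul_pow, mul_pow, hminus]
    rw [e1, e2]
    exact le_of_eq (by ring)
  rw [le_div_iff₀ (by linarith), Finset.sum_mul]
  calc _ ≤ ∑ i ∈ Finset.univ.filter (fun i => ∃ c : ℂ,
            Matrix.toEuclideanLin (kron3 (A i) (B i) (C i)) GHZ = c • Ψ),
          ‖Matrix.toEuclideanLin (kron3 (A i) (B i) (C i)) M‖ ^ 2 * (1 + t) :=
        Finset.sum_le_sum fun i hi => hbranch i (Finset.mem_filter.mp hi).2
    _ ≤ ∑ i, ‖Matrix.toEuclideanLin (kron3 (A i) (B i) (C i)) M‖ ^ 2 * (1 + t) :=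
        Finset.sum_le_sum_of_subset_of_nonneg (Finset.filter_subset _ _) fun _ _ _ =>
          mul_nonneg (sq_nonneg _) h1t.le
    _ = 1 + t := by
        rw [← Finset.sum_mul, sum_norm_sq_toEuclideanLin _ hcomplete, hMnorm, one_mul]
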